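/- arXiv:1607.03961 — 5 statements merged into one kernel-verified Lean document; each statement's English description precedes it below -/
import Mathlib

section
/- Let d ≥ 2 and define the d-dimensional pattern P of side length 2 over {0,1} by P_x = 0 if x_1 = 0 and P_x = 1 otherwise. Then P is not almost homogeneous, yet P is not removable. In fact, the binary d-dimensional array M of side length 4 defined by M_x = 0 if (x_1 = 0) or (x_1 = 1 and x_i ∈ {1,2} for all 2 ≤ i ≤ d) or (x_1 = 2 and x_i ∈ {0,3} for some 2 ≤ i ≤ d), and M_x = 1 otherwise, contains a copy of P starting at (1,…,1), and for every y ∈ [2]^d, flipping the entry of M at (1,…,1)+y creates a copy of P at a position where M has no copy of P. -/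
/-- `A`, a `d`-dimensional array of side length `n`, contains a copy of the
`d`-dimensional pattern `P` of side length `k` starting at `x`. -/
def HasCopy {Γ : Type*} (d n k : ℕ) (A P : (Fin d → ℕ) → Γ) (x : Fin d → ℕ) : Prop :=
  (∀ i, x i + k ≤ n) ∧ ∀ y : Fin d → ℕ, (∀ i, y i < k) → A (fun i => x i + y i) = P y

/-- The `d`-dimensional pattern `P` of side length `k` is removable over `{0,1}`. -/
def Removable (d k : ℕ) (P : (Fin d → ℕ) → Bool) : Prop :=
  ∀ (n : ℕ) (A : (Fin d → ℕ) → Bool) (x : Fin d → ℕ), HasCopy d n k A P x →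
    ∃ (y : Fin d → ℕ) (σ : Bool), (∀ i, y i < k) ∧ σ ≠ A (fun i => x i + y i) ∧
      ∀ x' : Fin d → ℕ,
        HasCopy d n k (Function.update A (fun i => x i + y i) σ) P x' →
        HasCopy d n k A P x'

/-- The `d`-dimensional pattern `P` of side length `k` is almost homogeneous. -/
def AlmostHomogeneous {Γ : Type*} (d k : ℕ) (P : (Fin d → ℕ) → Γ) : Prop :=
  ∃ (c : Fin d → ℕ) (a b : Γ), (∀ i, c i = 0 ∨ c i = k - 1) ∧ a ≠ b ∧ P c = b ∧
    ∀ y : Fin d → ℕ, (∀ i, y i < k) → y ≠ c → P y = a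

/-- The `2 × ⋯ × 2` pattern `P` with `P x = 0` iff `x₁ = 0` is not almost homogeneous,
yet not removable; indeed the described side-length-4 array `M` contains a `P`-copy
starting at `(1, …, 1)`, and flipping any entry of this copy creates a `P`-copy at a
position where `M` has none. -/
theorem stmt9 (d : ℕ) (hd : 2 ≤ d)
    (P M : (Fin d → ℕ) → Bool)
    (hP : ∀ x : Fin d → ℕ, (∀ i, x i < 2) →
      (P x = false ↔ x ⟨0, by omega⟩ = 0))
    (hM : ∀ x : Fin d → ℕ, (∀ i, x i < 4) →
      (M x = false ↔
        (x ⟨0, by omega⟩ = 0 ∨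
         (x ⟨0, by omega⟩ = 1 ∧
           ∀ i : Fin d, i ≠ ⟨0, by omega⟩ → (x i = 1 ∨ x i = 2)) ∨
         (x ⟨0, by omega⟩ = 2 ∧
           ∃ i : Fin d, i ≠ ⟨0, by omega⟩ ∧ (x i = 0 ∨ x i = 3))))) :
    ¬ AlmostHomogeneous d 2 P ∧
    ¬ Removable d 2 P ∧
    HasCopy d 4 2 M P (fun _ => 1) ∧
    ∀ y : Fin d → ℕ, (∀ i, y i < 2) →
      ∃ q : Fin d → ℕ,
        HasCopy d 4 2
          (Function.update M (fun i => 1 + y i) (!(M (fun i => 1 + y i)))) P q ∧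
        ¬ HasCopy d 4 2 M P q := by
  have hP' (z : Fin d → ℕ) (hz : ∀ i, z i < 2) : P z = decide (z ⟨0, by omega⟩ ≠ 0) := by
    have h := hP z hz
    cases hv : P z <;> simp_all
  have hinner (y : Fin d → ℕ) (hy : ∀ i, y i < 2) :
      M (fun i => 1 + y i) = decide (y ⟨0, by omega⟩ ≠ 0) := by
    have h := hM (fun i => 1 + y i) (fun i => by have := hy i; omega)
    have h12 : ∀ i, 1 + y i = 1 ∨ 1 + y i = 2 := fun i => by have := hy i; omega
    have hout : ¬ ∃ i : Fin d, i ≠ ⟨0, by omega⟩ ∧ (1 + y i = 0 ∨ 1 + y i = 3) := by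
      rintro ⟨i, -, hi⟩
      have := hy i
      omega
    by_cases h0 : y ⟨0, by omega⟩ = 0
    · simpa [h0] using h.2 (Or.inr (Or.inl ⟨by simp [h0], fun i _ => h12 i⟩))
    · simp only [ne_eq, h0, not_false_eq_true, decide_true]
      rw [← Bool.not_eq_false, h]
      rintro (h1 | ⟨h1, -⟩ | ⟨-, h1⟩)
      · omega
      · omega
      · exact hout h1
  have hcopy : HasCopy d 4 2 M P (fun _ => 1) :=
    ⟨fun i => by norm_num, fun y hy => by rw [hinner y hy, hP' y hy]⟩
  have hflip : ∀ y : Fin d → ℕ, (∀ i, y i < 2) →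
      ∃ q : Fin d → ℕ,
        HasCopy d 4 2
          (Function.update M (fun i => 1 + y i) (!(M (fun i => 1 + y i)))) P q ∧
        ¬ HasCopy d 4 2 M P q := by
    intro y hy
    refine ⟨fun i => 2 * y i, ⟨fun i => by have := hy i; dsimp only; omega, fun z hz => ?_⟩, ?_⟩
    · rw [hP' z hz]
      have hy0 := hy ⟨0, by omega⟩
      have hz0 := hz ⟨0, by omega⟩
      by_cases he : (fun i => 2 * y i + z i) = fun i => 1 + y i
      · rw [he, Function.update_self, hinner y hy, ← decide_not, decide_eq_decide]
        have := congrFun he ⟨0, by omega⟩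
        omega
      · rw [Function.update_of_ne he]
        have h := hM (fun i => 2 * y i + z i)
          (fun i => by have := hy i; have := hz i; omega)
        obtain ⟨j, hj⟩ := Function.ne_iff.1 he
        have hyj := hy j
        have hzj := hz j
        by_cases hz' : z ⟨0, by omega⟩ = 0
        · simp only [hz', ne_eq, not_true_eq_false, decide_false]
          rw [h]
          by_cases hy' : y ⟨0, by omega⟩ = 0
          · left; omega
          · right; right
            refine ⟨by omega, j, ?_, by omega⟩
            intro hj0
            rw [hj0] at hj
            omega
        · simp only [hz', ne_eq, not_false_eq_true, decide_true]
          rw [← Bool.not_eq_false, h]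
          rintro (h1 | ⟨h1, h2⟩ | ⟨h1, -⟩)
          · omega
          · have hj0 : j ≠ ⟨0, by omega⟩ := by
              intro hj0
              rw [hj0] at hj
              omega
            have := h2 j hj0
            omega
          · omega
    · rintro ⟨-, h⟩
      have hz : ∀ i, 1 - y i < 2 := fun i => by omega
      have h1 := h (fun i => 1 - y i) hz
      have he : (fun i => 2 * y i + (1 - y i)) = fun i => 1 + y i := by
        funext i
        have := hy i
        omega
      rw [he, hinner y hy, hP' _ hz, decide_eq_decide] at h1
      have := hy ⟨0, by omega⟩
      omega
  refine ⟨?_, ?_, hcopy, hflip⟩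
  · rintro ⟨c, a, b, -, -, -, hc⟩
    have key (s : ℕ) (hs : s < 2) : a = decide (s ≠ 0) := by
      have hp (t : ℕ) (ht : t < 2) (i : Fin d) :
          (if i = ⟨0, by omega⟩ then s else t) < 2 := by
        split_ifs <;> assumption
      obtain ⟨t, ht, hne⟩ : ∃ t < 2, (fun i : Fin d => if i = ⟨0, by omega⟩ then s else t) ≠ c := by
        refine ⟨1 - c ⟨1, by omega⟩, by omega, fun h => ?_⟩
        have := congrFun h ⟨1, by omega⟩
        simp only [Fin.mk.injEq, one_ne_zero, if_false] at this
        omega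
      rw [← hc _ (hp t ht) hne, hP' _ (hp t ht), if_pos rfl]
    simpa using (key 0 (by norm_num)).symm.trans (key 1 (by norm_num))
  · intro h
    obtain ⟨y, σ, hy, hσ, h⟩ := h 4 M _ hcopy
    obtain ⟨q, hq, hq'⟩ := hflip y hy
    rw [← Bool.eq_not.2 hσ] at hq
    exact hq' (h q hq)
end

section
/- Let P be a string of length k over {0,1} that is removable over {0,1}, and let S be a binary string of length n. Then the deletion number of S with respect to P equals the hitting number: d_P(S) = h_P(S). -/
/-- The string `S` of length `n` contains a copy of the pattern `P` of length `k`
at position `i`. -/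
def HasCopy1 (n k : ℕ) (S P : ℕ → Bool) (i : ℕ) : Prop :=
  i + k ≤ n ∧ ∀ j < k, S (i + j) = P j

/-- The string `S` of length `n` is `P`-free. -/
def PFree1 (n k : ℕ) (S P : ℕ → Bool) : Prop :=
  ∀ i : ℕ, ¬ HasCopy1 n k S P i

/-- The pattern `P` of length `k` is removable over `{0,1}`: for every copy of `P` in
a string `S`, some entry of the copy can be flipped without creating new `P`-copies. -/
def Removable1 (k : ℕ) (P : ℕ → Bool) : Prop :=
  ∀ (n : ℕ) (S : ℕ → Bool) (i : ℕ), HasCopy1 n k S P i →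
    ∃ j : ℕ, j < k ∧
      ∀ i' : ℕ, HasCopy1 n k (Function.update S (i + j) (!(S (i + j)))) P i' →
        HasCopy1 n k S P i'

/-- The deletion number `d_P(S)`: the minimum number of entries of `S` that must be
changed to obtain a `P`-free string. -/
noncomputable def delNum1 (n k : ℕ) (S P : ℕ → Bool) : ℕ :=
  sInf {m : ℕ | ∃ S' : ℕ → Bool,
    {i : ℕ | i < n ∧ S' i ≠ S i}.ncard = m ∧ PFree1 n k S' P}

/-- The hitting number `h_P(S)`: the minimum size of a set `H ⊆ [n]` intersecting
every copy of `P` in `S`. -/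
noncomputable def hitNum1 (n k : ℕ) (S P : ℕ → Bool) : ℕ :=
  sInf {m : ℕ | ∃ H : Set ℕ, H ⊆ {i : ℕ | i < n} ∧ H.Finite ∧ H.ncard = m ∧
    ∀ i : ℕ, HasCopy1 n k S P i → ∃ j : ℕ, j < k ∧ i + j ∈ H}

theorem HasCopy1.period {n k : ℕ} {S P : ℕ → Bool} {a d : ℕ} (ha : HasCopy1 n k S P a)
    (hb : HasCopy1 n k S P (a + d)) {x : ℕ} (hx : x + d < k) : P (x + d) = P x := by
  rw [← ha.2 _ hx, ← hb.2 x (by omega)]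
  congr 1
  omega

/-- In the union of two copies at distance `d`, all windows of length `d` have equal weight. -/
theorem HasCopy1.sum_window {n k : ℕ} {S P : ℕ → Bool} {a d : ℕ} (ha : HasCopy1 n k S P a)
    (hb : HasCopy1 n k S P (a + d)) (hd : d < k) {e : ℕ} (he : e ≤ k) :
    ∑ x ∈ Finset.range d, (S (a + e + x)).toNat = ∑ x ∈ Finset.range d, (P x).toNat := by
  induction e with
  | zero =>
    refine Finset.sum_congr rfl fun x hx => ?_
    rw [Finset.mem_range] at hx
    rw [add_zero, ha.2 x (by omega)]
  | succ e ih =>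
    rw [← ih (by omega)]
    have hper : S (a + e + d) = S (a + e) := by
      rw [ha.2 e (by omega), ← hb.2 e (by omega)]
      congr 1
      omega
    have h₁ := Finset.sum_range_succ (fun x => (S (a + e + x)).toNat) d
    have h₂ := Finset.sum_range_succ' (fun x => (S (a + e + x)).toNat) d
    have h₃ : ∀ x, a + (e + 1) + x = a + e + (x + 1) := fun x => by omega
    simp only [h₃]
    simp only [hper, add_zero] at h₁ h₂
    omega

theorem HasCopy1.of_update {n k : ℕ} {S P : ℕ → Bool} {q c : ℕ} {v : Bool}
    (hc : HasCopy1 n k (Function.update S q v) P c) (hq : ¬ (c ≤ q ∧ q < c + k)) :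
    HasCopy1 n k S P c := by
  refine ⟨hc.1, fun j hj => ?_⟩
  rw [← hc.2 j hj, Function.update_of_ne (by omega)]

/-- If two copies overlap, flipping the last entry of the left one creates no copy. -/
theorem HasCopy1.of_flip_last {n k : ℕ} {S P : ℕ → Bool} {a d c : ℕ} (ha : HasCopy1 n k S P a)
    (hb : HasCopy1 n k S P (a + d)) (hd₀ : 0 < d) (hd : d < k)
    (hc : HasCopy1 n k (Function.update S (a + (k - 1)) (!(S (a + (k - 1))))) P c) :
    HasCopy1 n k S P c := by
  by_cases hq : ¬ (c ≤ a + (k - 1) ∧ a + (k - 1) < c + k)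
  · exact hc.of_update hq
  exfalso
  push Not at hq
  obtain ⟨hq₁, hq₂⟩ := hq
  have hSq : S (a + (k - 1)) = P (k - 1) := ha.2 _ (by omega)
  have hPq : P (a + (k - 1) - c) = !(P (k - 1)) := by
    rw [← hc.2 _ (by omega), Nat.add_sub_cancel' hq₁, Function.update_self, hSq]
  have hother : ∀ x, c ≤ x → x < c + k → x ≠ a + (k - 1) → P (x - c) = S x := by
    intro x h₁ h₂ h₃
    rw [← hc.2 _ (by omega), Nat.add_sub_cancel' h₁, Function.update_of_ne h₃]
  by_cases hcb : a + d ≤ c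
  · have h₁ := hother (a + d + (k - 1)) (by omega) (by omega) (by omega)
    rw [hb.2 _ (by omega)] at h₁
    have h₂ := ha.period hb (x := a + (k - 1) - c) (by omega)
    rw [show a + (k - 1) - c + d = a + d + (k - 1) - c by omega, h₁, hPq] at h₂
    simp at h₂
  by_cases hcd : c + d ≤ a + (k - 1)
  · have h₁ := hother (a + (k - 1 - d)) (by omega) (by omega) (by omega)
    rw [ha.2 _ (by omega)] at h₁
    have h₂ := ha.period hb (x := a + (k - 1 - d) - c) (by omega)
    have h₃ := ha.period hb (x := k - 1 - d) (by omega)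
    rw [show a + (k - 1 - d) - c + d = a + (k - 1) - c by omega, h₁, hPq, ← h₃,
      show k - 1 - d + d = k - 1 by omega] at h₂
    simp at h₂
  · have h₁ := ha.sum_window hb hd (e := c - a) (by omega)
    rw [Nat.add_sub_cancel' (by omega)] at h₁
    have hmem : a + (k - 1) - c ∈ Finset.range d := Finset.mem_range.2 (by omega)
    rw [← Finset.add_sum_erase _ _ hmem, ← Finset.add_sum_erase _ (fun x => (P x).toNat) hmem,
      Finset.sum_congr rfl (g := fun x => (P x).toNat), Nat.add_right_cancel_iff,
      Nat.add_sub_cancel' hq₁, hPq, hSq] at h₁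
    · cases h : P (k - 1) <;> simp [h] at h₁
    · intro x hx
      rw [Finset.mem_erase, Finset.mem_range] at hx
      rw [← hother (c + x) (by omega) (by omega) (by omega), Nat.add_sub_cancel_left]

theorem Removable1.pos {k : ℕ} {P : ℕ → Bool} (hrem : Removable1 k P) : 0 < k := by
  by_contra hk
  obtain rfl : k = 0 := by omega
  obtain ⟨j, hj, -⟩ := hrem 0 P 0 ⟨le_rfl, fun j hj => absurd hj (Nat.not_lt_zero j)⟩
  exact Nat.not_lt_zero j hj

/-- One flip inside the leftmost copy destroys every copy meeting it and creates none. -/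
theorem Removable1.exists_flip {n k : ℕ} {S P : ℕ → Bool} {a : ℕ} (hrem : Removable1 k P)
    (ha : HasCopy1 n k S P a) (hmin : ∀ c, HasCopy1 n k S P c → a ≤ c) :
    ∃ q, ∀ c, HasCopy1 n k (Function.update S q (!(S q))) P c →
      HasCopy1 n k S P c ∧ a + k ≤ c := by
  have hk := hrem.pos
  have hdestroy : ∀ q c, c ≤ q → q < c + k → HasCopy1 n k S P c →
      ¬ HasCopy1 n k (Function.update S q (!(S q))) P c := by
    intro q c h₁ h₂ h₃ h₄
    have h₅ := h₄.2 (q - c) (by omega)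
    rw [← h₃.2 (q - c) (by omega), Nat.add_sub_cancel' h₁, Function.update_self] at h₅
    simp at h₅
  by_cases hover : ∃ d, 0 < d ∧ d < k ∧ HasCopy1 n k S P (a + d)
  · obtain ⟨d, hd₀, hd, hb⟩ := hover
    refine ⟨a + (k - 1), fun c hc => ?_⟩
    have hc' := ha.of_flip_last hb hd₀ hd hc
    refine ⟨hc', ?_⟩
    by_contra hlt
    have := hmin c hc'
    exact hdestroy _ c (by omega) (by omega) hc' hc
  · obtain ⟨j, hj, hflip⟩ := hrem n S a ha
    refine ⟨a + j, fun c hc => ⟨hflip c hc, ?_⟩⟩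
    by_contra hlt
    have hac := hmin c (hflip c hc)
    rcases hac.eq_or_lt with rfl | hac
    · exact hdestroy _ a (by omega) (by omega) ha hc
    · refine hover ⟨c - a, by omega, by omega, ?_⟩
      rw [Nat.add_sub_cancel' hac.le]
      exact hflip c hc

theorem Removable1.exists_pfree {n k : ℕ} {P : ℕ → Bool} (hrem : Removable1 k P) (m : ℕ)
    (S : ℕ → Bool) (H : Finset ℕ) (hH : H.card ≤ m)
    (hhit : ∀ i, HasCopy1 n k S P i → ∃ j < k, i + j ∈ H) :
    ∃ S' : ℕ → Bool, PFree1 n k S' P ∧ {i : ℕ | i < n ∧ S' i ≠ S i}.ncard ≤ m := by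
  classical
  induction m generalizing S H with
  | zero =>
    obtain rfl : H = ∅ := Finset.card_eq_zero.1 (by omega)
    refine ⟨S, fun i hi => ?_, by simp⟩
    obtain ⟨j, -, hj⟩ := hhit i hi
    exact Finset.notMem_empty _ hj
  | succ m ih =>
    by_cases hcopy : ∃ a, HasCopy1 n k S P a
    · obtain ⟨q, hq⟩ := hrem.exists_flip (Nat.find_spec hcopy) fun c hc => Nat.find_min' hcopy hc
      obtain ⟨j, hj, hjH⟩ := hhit _ (Nat.find_spec hcopy)
      obtain ⟨S', hfree, hcard⟩ := ih (Function.update S q (!(S q)))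
        (H.erase (Nat.find hcopy + j)) (by rw [Finset.card_erase_of_mem hjH]; omega)
        fun i hi => by
          obtain ⟨hi, hle⟩ := hq i hi
          obtain ⟨l, hl, hlH⟩ := hhit i hi
          exact ⟨l, hl, Finset.mem_erase.2 ⟨by omega, hlH⟩⟩
      refine ⟨S', hfree, ?_⟩
      have hfin : {i : ℕ | i < n ∧ S' i ≠ Function.update S q (!(S q)) i}.Finite :=
        (Set.finite_lt_nat n).subset fun i hi => hi.1
      refine (Set.ncard_le_ncard (fun i hi => ?_) (hfin.insert q)).trans
        ((Set.ncard_insert_le q _).trans (Nat.succ_le_succ hcard))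
      rcases eq_or_ne i q with h | h
      · exact Or.inl h
      · exact Or.inr ⟨hi.1, by rw [Function.update_of_ne h]; exact hi.2⟩
    · exact ⟨S, fun i hi => hcopy ⟨i, hi⟩, by simp⟩

/-- For a removable binary pattern `P`, the deletion number of any binary string
equals its hitting number. -/
theorem stmt10 (n k : ℕ) (P : ℕ → Bool) (hrem : Removable1 k P) (S : ℕ → Bool) :
    delNum1 n k S P = hitNum1 n k S P := by
  have hk := hrem.pos
  apply le_antisymm
  · obtain ⟨H, -, hfin, hcard, hhit⟩ := Nat.sInf_mem (s := {m : ℕ | ∃ H : Set ℕ,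
        H ⊆ {i : ℕ | i < n} ∧ H.Finite ∧ H.ncard = m ∧
          ∀ i : ℕ, HasCopy1 n k S P i → ∃ j : ℕ, j < k ∧ i + j ∈ H})
      ⟨_, {i | i < n}, subset_rfl, Set.finite_lt_nat n, rfl,
        fun i hi => ⟨0, hk, show i + 0 < n by have := hi.1; omega⟩⟩
    obtain ⟨S', hfree, hle⟩ := hrem.exists_pfree (n := n) _ S hfin.toFinset
      (by rw [← Set.ncard_eq_toFinset_card H hfin]) (by simpa using hhit)
    have hdel : delNum1 n k S P ≤ {i : ℕ | i < n ∧ S' i ≠ S i}.ncard :=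
      Nat.sInf_le ⟨S', rfl, hfree⟩
    exact hdel.trans (hle.trans_eq hcard)
  · obtain ⟨S₀, hS₀, -⟩ := hrem.exists_pfree (n := n) _ S (Finset.range n) le_rfl
      fun i hi => ⟨0, hk, Finset.mem_range.2 (by have := hi.1; omega)⟩
    obtain ⟨S', hcard, hfree⟩ := Nat.sInf_mem (s := {m : ℕ | ∃ S' : ℕ → Bool,
      {i : ℕ | i < n ∧ S' i ≠ S i}.ncard = m ∧ PFree1 n k S' P}) ⟨_, S₀, rfl, hS₀⟩
    have hsub : {i : ℕ | i < n ∧ S' i ≠ S i} ⊆ {i | i < n} := fun i hi => hi.1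
    refine Nat.sInf_le ⟨_, hsub, (Set.finite_lt_nat n).subset hsub, hcard, fun i hi => ?_⟩
    by_contra! hno
    refine hfree i ⟨hi.1, fun j hj => ?_⟩
    rw [← hi.2 j hj]
    by_contra hne
    exact hno j hj ⟨by have := hi.1; omega, hne⟩
end

section
/- Let P be a pattern of length k over {0,1}, let S be a binary string of length n containing a copy of P at position p, and let x ∈ [k]. Let S' be the string obtained from S by flipping the entry at p+x. Then there is at most one position q such that S' contains a copy of P at q but S does not contain a copy of P at q. -/
/-- A word on `{0, …, d + c}` that is invariant under the shifts by `c` and by `d`, except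
possibly for the two shifts that start at or end in the letter `d`, has equal letters at `d`
and `0`: follow the rotation by `c` modulo `d + c` from `0` until it reaches `d`. -/
theorem apply_eq_apply_zero_of_shifts {α : Type*} (Q : ℕ → α) (d c : ℕ) (hc : 0 < c)
    (h_up : ∀ v < d, Q (v + c) = Q v) (h_down : ∀ u, 0 < u → u < c → Q (u + d) = Q u) :
    Q d = Q 0 := by
  by_contra hne
  have orbit : ∀ m : ℕ, ∃ v < d + c, Q v = Q 0 ∧ ((d + c : ℕ) : ℤ) ∣ v - m * c := by
    intro m
    induction m with
    | zero => exact ⟨0, by omega, rfl, by simp⟩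
    | succ m ih =>
      obtain ⟨v, hv, hQ, t, ht⟩ := ih
      rcases lt_trichotomy v d with h | h | h
      · refine ⟨v + c, by omega, (h_up v h).trans hQ, t, ?_⟩
        push_cast at ht ⊢
        linarith
      · exact absurd (h ▸ hQ) hne
      · obtain ⟨u, rfl⟩ := Nat.exists_eq_add_of_lt h
        have hu := h_down (u + 1) (by omega) (by omega)
        rw [show u + 1 + d = d + u + 1 by ring] at hu
        refine ⟨u + 1, by omega, hu.symm.trans hQ, t - 1, ?_⟩
        push_cast at ht ⊢
        linarith
  obtain ⟨v, hv, hQ, hdvd⟩ := orbit (d + c - 1)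
  have hdvd' : ((d + c : ℕ) : ℤ) ∣ v - d := by
    obtain ⟨t, ht⟩ := hdvd
    refine ⟨t + c - 1, ?_⟩
    rw [Nat.cast_sub (by omega)] at ht
    push_cast at ht ⊢
    linarith
  have hzero := Int.eq_zero_of_abs_lt_dvd hdvd' (by rw [abs_lt]; omega)
  have hvd : v = d := by omega
  exact hne (hvd ▸ hQ)

/-- A copy created by flipping the entry at `z` contains `z`, and agrees with the original
string elsewhere. -/
theorem exists_of_new_copy {n k : ℕ} {S P : ℕ → Bool} {z q : ℕ}
    (hnew : HasCopy1 n k (Function.update S z (!(S z))) P q) (hold : ¬ HasCopy1 n k S P q) :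
    (∃ j < k, q + j = z ∧ P j = !(S z)) ∧ ∀ j < k, q + j ≠ z → S (q + j) = P j := by
  obtain ⟨hn, h⟩ := hnew
  have hrest : ∀ j < k, q + j ≠ z → S (q + j) = P j := fun j hj hz => by
    simpa [Function.update_of_ne hz] using h j hj
  refine ⟨?_, hrest⟩
  by_contra! hcon
  refine hold ⟨hn, fun j hj => hrest j hj fun hz => hcon j hj hz ?_⟩
  simpa [hz] using (h j hj).symm

/-- Flipping one entry of a copy cannot create copies at two positions `q < q'`. -/
theorem not_two_new_copies {n k : ℕ} {P S : ℕ → Bool} {p : ℕ} (hp : HasCopy1 n k S P p)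
    {x : ℕ} (hx : x < k) {q q' : ℕ} (hlt : q < q')
    (hq : HasCopy1 n k (Function.update S (p + x) (!(S (p + x)))) P q)
    (hq_old : ¬ HasCopy1 n k S P q)
    (hq' : HasCopy1 n k (Function.update S (p + x) (!(S (p + x)))) P q')
    (hq'_old : ¬ HasCopy1 n k S P q') : False := by
  obtain ⟨⟨j, hj, hqj, hPj⟩, h⟩ := exists_of_new_copy hq hq_old
  obtain ⟨⟨j', hj', hqj', hPj'⟩, h'⟩ := exists_of_new_copy hq' hq'_old
  have hS := hp.2
  rw [hS x hx] at hPj hPj'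
  have hjx : P j ≠ P x := by simp [hPj]
  have hjx' : P j' ≠ P x := by simp [hPj']
  have hne : j ≠ x := fun e => hjx (e ▸ rfl)
  have hne' : j' ≠ x := fun e => hjx' (e ▸ rfl)
  have transfer : ∀ {a b i l : ℕ}, S a = P i → S b = P l → a = b → P i = P l :=
    fun ha hb hab => ha.symm.trans (hab ▸ hb)
  by_cases hxj' : x < j'
  · have h₁ := transfer (h (x + (j - j')) (by omega) (by omega)) (h' x hx (by omega)) (by omega)
    have h₂ := transfer (h' j (by omega) (by omega)) (hS (x + (j - j')) (by omega)) (by omega)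
    exact hjx (h₂.trans h₁)
  by_cases hjx_lt : j < x
  · have h₁ := transfer (h' (x - (j - j')) (by omega) (by omega)) (h x hx (by omega)) (by omega)
    have h₂ := transfer (h j' (by omega) (by omega)) (hS (x - (j - j')) (by omega)) (by omega)
    exact hjx' (h₂.trans h₁)
  have key := apply_eq_apply_zero_of_shifts (fun w => P (j' + w)) (x - j') (j - x) (by omega)
    (fun v hv => transfer (h (j' + (v + (j - x))) (by omega) (by omega))
      (hS (j' + v) (by omega)) (by omega))
    (fun u hu huc => transfer (hS (j' + (u + (x - j'))) (by omega))
      (h' (j' + u) (by omega) (by omega)) (by omega))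
  simp only [add_zero, show j' + (x - j') = x by omega] at key
  exact hjx' key.symm

/-- Flipping any single bit of a `P`-copy in a binary string creates at most one new
`P`-copy. -/
theorem stmt11 (n k : ℕ) (P S : ℕ → Bool) (p : ℕ) (hp : HasCopy1 n k S P p)
    (x : ℕ) (hx : x < k) :
    ∀ q q' : ℕ,
      (HasCopy1 n k (Function.update S (p + x) (!(S (p + x)))) P q ∧
        ¬ HasCopy1 n k S P q) →
      (HasCopy1 n k (Function.update S (p + x) (!(S (p + x)))) P q' ∧
        ¬ HasCopy1 n k S P q') →
      q = q' := by
  rintro q q' ⟨hq, hq_old⟩ ⟨hq', hq'_old⟩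
  rcases lt_trichotomy q q' with hlt | heq | hgt
  · exact (not_two_new_copies hp hx hlt hq hq_old hq' hq'_old).elim
  · exact heq
  · exact (not_two_new_copies hp hx hgt hq' hq'_old hq hq_old).elim
end

section
/- Let k ≥ 1 and let P be the binary pattern of length k with P_0 = 1 and P_l = 0 for 1 ≤ l ≤ k−1. A binary string S of length n is P-free if and only if S contains no P-evidence, i.e., there is no pair (i,j) with 0 ≤ i < j ≤ n−k+1 such that S_i = 1 and S_l = 0 for all j ≤ l ≤ j+k−2. -/
/-- For `P = 10^{k-1}`, the pair `(i, j)` with `0 ≤ i < j ≤ n - k + 1` is a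
`P`-evidence in `S` if `S i = 1` and `S l = 0` for all `j ≤ l ≤ j + k - 2`. -/
def Evidence (n k : ℕ) (S : ℕ → Bool) (i j : ℕ) : Prop :=
  i < j ∧ j + k ≤ n + 1 ∧ S i = true ∧
    ∀ l : ℕ, j ≤ l → l + 2 ≤ j + k → S l = false

/-- For the pattern `P = 10^{k-1}`, a binary string `S` of length `n` is `P`-free
if and only if it contains no `P`-evidence. -/
theorem stmt16 (n k : ℕ) (hk : 1 ≤ k) (P : ℕ → Bool)
    (hP0 : P 0 = true) (hPl : ∀ l, 1 ≤ l → l < k → P l = false)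
    (S : ℕ → Bool) :
    PFree1 n k S P ↔ ¬ ∃ i j : ℕ, Evidence n k S i j := by
  constructor
  · rintro hfree ⟨i, j, hij, hjn, hSi, hzero⟩
    -- The last `1` before position `j` starts a copy of the pattern.
    let m := Nat.findGreatest (fun t => S t = true) (j - 1)
    have hm : S m = true :=
      Nat.findGreatest_spec (P := fun t => S t = true) (Nat.le_sub_one_of_lt hij) hSi
    have hmj : m ≤ j - 1 := Nat.findGreatest_le (j - 1)
    refine hfree m ⟨by omega, fun l hl => ?_⟩
    rcases Nat.eq_zero_or_pos l with rfl | hpos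
    · rw [hP0, Nat.add_zero, hm]
    · rw [hPl l hpos hl]
      by_cases hlj : m + l < j
      · exact Bool.eq_false_of_not_eq_true
          (Nat.findGreatest_is_greatest (P := fun t => S t = true) (n := j - 1)
            (Nat.lt_add_of_pos_right hpos) (by omega))
      · exact hzero _ (by omega) (by omega)
  · rintro hev i ⟨hin, hcopy⟩
    refine hev ⟨i, i + 1, by omega, by omega, ?_, fun l hil hlk => ?_⟩
    · simpa [hP0] using hcopy 0 hk
    · have h := hcopy (l - i) (by omega)
      rwa [hPl (l - i) (by omega) (by omega), Nat.add_sub_cancel' (by omega)] at h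
end

section
/- Let k ≥ 1, let P be the binary pattern of length k with P_0 = 1 and P_l = 0 for 1 ≤ l ≤ k−1, and let S be a binary string of length n. Then the deletion number d_P(S) equals d_E(S), the maximum number of pairwise non-overlapping P-evidences in S. -/
/-- The maximum number `d_E(S)` of pairwise non-overlapping `P`-evidences in `S`,
where `(i, j)` and `(i', j')` are non-overlapping if `i ≠ i'` and `|j - j'| ≥ k - 1`. -/
noncomputable def evNum (n k : ℕ) (S : ℕ → Bool) : ℕ :=
  sSup {m : ℕ | ∃ T : Finset (ℕ × ℕ), T.card = m ∧
    (∀ e ∈ T, Evidence n k S e.1 e.2) ∧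
    ∀ e ∈ T, ∀ e' ∈ T, e ≠ e' →
      e.1 ≠ e'.1 ∧ (k : ℤ) - 1 ≤ |(e.2 : ℤ) - (e'.2 : ℤ)|}

/-- The finite set `T` consists of pairwise non-overlapping `P`-evidences in `S`. -/
def IsEvidenceFamily (n k : ℕ) (S : ℕ → Bool) (T : Finset (ℕ × ℕ)) : Prop :=
  (∀ e ∈ T, Evidence n k S e.1 e.2) ∧
    ∀ e ∈ T, ∀ e' ∈ T, e ≠ e' →
      e.1 ≠ e'.1 ∧ (k : ℤ) - 1 ≤ |(e.2 : ℤ) - (e'.2 : ℤ)|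

/-- Every `P`-evidence of `S` is hit by a modification that makes the string `P`-free. -/
lemma Evidence.exists_changed {n k : ℕ} {P S S' : ℕ → Bool} (hk : 1 ≤ k)
    (hP0 : P 0 = true) (hPl : ∀ l, 1 ≤ l → l < k → P l = false)
    (hfree : PFree1 n k S' P) {i j : ℕ} (h : Evidence n k S i j) :
    ∃ x, x < n ∧ S' x ≠ S x ∧ (x = i ∨ (j ≤ x ∧ x + 2 ≤ j + k)) := by
  obtain ⟨hij, hjn, hSi, hS0⟩ := h
  by_contra! hno
  have hi : S' i = true := by
    by_contra hne
    exact (hno i (by omega) (by rw [hSi]; exact hne)).1 rfl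
  have h0 : ∀ l, j ≤ l → l + 2 ≤ j + k → S' l = false := by
    intro l h1 h2
    by_contra hne
    have := (hno l (by omega) (by rw [hS0 l h1 h2]; exact hne)).2 h1
    omega
  set p := Nat.findGreatest (fun q => S' q = true) (j - 1) with hp
  have hp1 : S' p = true :=
    Nat.findGreatest_spec (P := fun q => S' q = true) (by omega : i ≤ j - 1) hi
  have hpj : p ≤ j - 1 := Nat.findGreatest_le _
  refine hfree p ⟨by omega, fun l hl => ?_⟩
  rcases Nat.eq_zero_or_pos l with rfl | hl0
  · simpa [hP0] using hp1
  · rw [hPl l hl0 hl]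
    by_cases hlj : p + l ≤ j - 1
    · have := Nat.findGreatest_is_greatest (P := fun q => S' q = true)
        (show p < p + l by omega) hlj
      simpa using this
    · exact h0 _ (by omega) (by omega)

lemma IsEvidenceFamily.card_le {n k : ℕ} {P S S' : ℕ → Bool} (hk : 1 ≤ k)
    (hP0 : P 0 = true) (hPl : ∀ l, 1 ≤ l → l < k → P l = false)
    (hfree : PFree1 n k S' P) {T : Finset (ℕ × ℕ)} (hT : IsEvidenceFamily n k S T) :
    T.card ≤ ((Finset.range n).filter fun i => S' i ≠ S i).card := by
  obtain ⟨hev, hno⟩ := hT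
  have hex : ∀ e : ℕ × ℕ, ∃ x, e ∈ T →
      x < n ∧ S' x ≠ S x ∧ (x = e.1 ∨ (e.2 ≤ x ∧ x + 2 ≤ e.2 + k)) := by
    intro e
    by_cases he : e ∈ T
    · obtain ⟨x, hx⟩ := (hev e he).exists_changed hk hP0 hPl hfree
      exact ⟨x, fun _ => hx⟩
    · exact ⟨0, fun h => absurd h he⟩
  choose g hg using hex
  refine Finset.card_le_card_of_injOn g (fun e he => ?_) (fun e he e' he' hee => ?_)
  · have := hg e he
    simpa using ⟨this.1, this.2.1⟩
  · by_contra hne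
    obtain ⟨h1, h2⟩ := hno e he e' he' hne
    obtain ⟨-, -, hx⟩ := hg e he
    obtain ⟨-, -, hx'⟩ := hg e' he'
    obtain ⟨-, -, hS1, hS0⟩ := hev e he
    obtain ⟨-, -, hS1', hS0'⟩ := hev e' he'
    rw [← hee] at hx'
    rcases hx with hx | hx <;> rcases hx' with hx' | hx'
    · omega
    · have := hS0' _ hx'.1 hx'.2
      rw [hx, hS1] at this
      cases this
    · have := hS0 _ hx.1 hx.2
      rw [hx', hS1'] at this
      cases this
    · rcases abs_cases ((e.2 : ℤ) - (e'.2 : ℤ)) with h | h <;> omega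

/-- The invariant of a left-to-right scan of `S` that greedily matches disjoint blocks of `k - 1`
zeros with earlier ones: `b` is the start of the current run of unused zeros. Either all ones seen
so far are matched, or some one is unmatched and `S'` is a modification vanishing before `t` with
no block of `k - 1` zeros from `t` on. -/
def GreedyState (n k : ℕ) (S : ℕ → Bool) (T : Finset (ℕ × ℕ)) (b : ℕ) : Prop :=
  IsEvidenceFamily n k S T ∧ (∀ e ∈ T, e.2 + k ≤ b + 1) ∧ b ≤ n ∧ n + 1 < b + k ∧
    (∀ l, b ≤ l → l < n → S l = false) ∧
    ((∀ i < n, S i = true → i ∈ T.image Prod.fst) ∨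
      ((∃ i < n, S i = true ∧ i ∉ T.image Prod.fst) ∧
        ∃ (S' : ℕ → Bool) (t : ℕ),
          ((Finset.range n).filter fun i => S' i ≠ S i).card ≤ T.card ∧
          (∀ i < t, S' i = false) ∧
          (∀ p, t ≤ p → p + k ≤ n + 1 → ∃ l, p ≤ l ∧ l + 2 ≤ p + k ∧ S' l = true) ∧
          t < b ∧ S' (b - 1) = true))

lemma IsEvidenceFamily.mono {m n k : ℕ} {S : ℕ → Bool} {T : Finset (ℕ × ℕ)} (hmn : m ≤ n)
    (h : IsEvidenceFamily m k S T) : IsEvidenceFamily n k S T :=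
  ⟨fun e he => by
    obtain ⟨h1, h2, h3⟩ := h.1 e he
    exact ⟨h1, by omega, h3⟩, h.2⟩

lemma card_ones_le {n : ℕ} {S : ℕ → Bool} {T : Finset (ℕ × ℕ)}
    (h : ∀ i < n, S i = true → i ∈ T.image Prod.fst) :
    ((Finset.range n).filter fun i => S i = true).card ≤ T.card := by
  refine (Finset.card_le_card fun i hi => ?_).trans (Finset.card_image_le (f := Prod.fst))
  rw [Finset.mem_filter, Finset.mem_range] at hi
  exact h i hi.1 hi.2

/-- Extending a family by one evidence whose block starts after all blocks of the family. -/
lemma IsEvidenceFamily.insert {n k : ℕ} {S : ℕ → Bool} {T : Finset (ℕ × ℕ)} {i b : ℕ}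
    (h : IsEvidenceFamily n k S T) (hb : ∀ e ∈ T, e.2 + k ≤ b + 1)
    (hi : i ∉ T.image Prod.fst) (hev : Evidence n k S i b) :
    IsEvidenceFamily n k S (insert (i, b) T) := by
  have hne : ∀ e ∈ T, e.1 ≠ i := fun e he hei =>
    hi (Finset.mem_image.2 ⟨e, he, hei⟩)
  refine ⟨fun e he => ?_, fun e he e' he' hee => ?_⟩
  · rcases Finset.mem_insert.1 he with rfl | he
    · exact hev
    · exact h.1 e he
  · rcases Finset.mem_insert.1 he with rfl | he <;>
      rcases Finset.mem_insert.1 he' with rfl | he'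
    · exact absurd rfl hee
    · have := hb _ he'
      exact ⟨(hne _ he').symm, le_trans (by push_cast; omega) (le_abs_self _)⟩
    · have := hb _ he
      exact ⟨hne _ he, le_trans (by push_cast; omega) (neg_le_abs _)⟩
    · exact h.2 e he e' he' hee

lemma exists_greedyState {k : ℕ} (hk : 2 ≤ k) (S : ℕ → Bool) (n : ℕ) :
    ∃ T b, GreedyState n k S T b := by
  induction n with
  | zero =>
    exact ⟨∅, 0, ⟨by simp, by simp⟩, by simp, le_rfl, by omega, by simp, Or.inl (by simp)⟩
  | succ n ih =>
    obtain ⟨T, b, hT, hb, hbn, hnb, hz, hAB⟩ := ih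
    have hT' := hT.mono n.le_succ
    have hfst : ∀ i ∈ T.image Prod.fst, i < b := by
      intro i hi
      obtain ⟨e, he, rfl⟩ := Finset.mem_image.1 hi
      have := (hT.1 e he).1
      have := hb e he
      omega
    cases hSn : S n with
    | true =>
      refine ⟨T, n + 1, hT', fun e he => (hb e he).trans (by omega), le_rfl, by omega,
        fun l _ _ => by omega, Or.inr ?_⟩
      have hn : n ∉ T.image Prod.fst := fun h => by
        have := hfst n h
        omega
      refine ⟨⟨n, by omega, hSn, hn⟩, ?_⟩
      rcases hAB with hA | ⟨-, S', t, hc, h0, hw, htb, hS'⟩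
      · refine ⟨fun i => decide (i = n), n, ?_, ?_, ?_, by omega, by simp⟩
        · refine (Finset.card_le_card fun i hi => ?_).trans (card_ones_le hA)
          simp only [Finset.mem_filter, Finset.mem_range] at hi ⊢
          have hin : i ≠ n := by
            rintro rfl
            simp [hSn] at hi
          refine ⟨by omega, ?_⟩
          simpa [hin] using hi.2
        · intro i hi
          simpa using hi.ne
        · exact fun p hp hpk => ⟨n, by omega, by omega, by simp⟩
      · refine ⟨Function.update S' n true, t, ?_, ?_, ?_, by omega, by simp⟩
        · refine (Finset.card_le_card fun i hi => ?_).trans hc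
          simp only [Finset.mem_filter, Finset.mem_range] at hi ⊢
          have hin : i ≠ n := by
            rintro rfl
            simp [hSn] at hi
          refine ⟨by omega, ?_⟩
          simpa [hin] using hi.2
        · intro i hi
          rw [Function.update_of_ne (by omega)]
          exact h0 i hi
        · intro p hp hpk
          by_cases hpn : p + k ≤ n + 1
          · obtain ⟨l, h1, h2, h3⟩ := hw p hp hpn
            exact ⟨l, h1, h2, by rw [Function.update_of_ne (by omega)]; exact h3⟩
          · exact ⟨n, by omega, by omega, by simp⟩
    | false =>
      have hz' : ∀ l, b ≤ l → l < n + 1 → S l = false := by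
        intro l h1 h2
        rcases Nat.lt_succ_iff_lt_or_eq.1 h2 with h | rfl
        · exact hz l h1 h
        · exact hSn
      have hA' : ∀ T' : Finset (ℕ × ℕ), (∀ i < n, S i = true → i ∈ T'.image Prod.fst) →
          ∀ i < n + 1, S i = true → i ∈ T'.image Prod.fst := by
        intro T' h i hi hSi
        rcases Nat.lt_succ_iff_lt_or_eq.1 hi with h' | rfl
        · exact h i h' hSi
        · simp [hSn] at hSi
      by_cases hlen : n + 2 < b + k
      · refine ⟨T, b, hT', hb, by omega, by omega, hz', ?_⟩
        rcases hAB with hA | ⟨⟨i, hi, hSi, hiT⟩, S', t, hc, h0, hw, htb, hS'⟩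
        · exact Or.inl (hA' T hA)
        · refine Or.inr ⟨⟨i, by omega, hSi, hiT⟩, Function.update S' n false, t,
            ?_, ?_, ?_, htb, ?_⟩
          · refine (Finset.card_le_card fun i hi => ?_).trans hc
            simp only [Finset.mem_filter, Finset.mem_range] at hi ⊢
            have hin : i ≠ n := by
              rintro rfl
              simp [hSn] at hi
            refine ⟨by omega, ?_⟩
            simpa [hin] using hi.2
          · intro i hi
            rw [Function.update_of_ne (by omega)]
            exact h0 i hi
          · intro p hp hpk
            by_cases hpn : p + k ≤ n + 1
            · obtain ⟨l, h1, h2, h3⟩ := hw p hp hpn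
              exact ⟨l, h1, h2, by rw [Function.update_of_ne (by omega)]; exact h3⟩
            · exact ⟨b - 1, by omega, by omega, by
                rw [Function.update_of_ne (by omega)]; exact hS'⟩
          · rw [Function.update_of_ne (by omega)]
            exact hS'
      · rcases hAB with hA | ⟨⟨i, hi, hSi, hiT⟩, S', t, hc, h0, hw, htb, hS'⟩
        · exact ⟨T, n + 1, hT', fun e he => (hb e he).trans (by omega), le_rfl, by omega,
            fun l _ _ => by omega, Or.inl (hA' T hA)⟩
        · have hib : i < b := by
            by_contra hib
            rw [hz i (by omega) hi] at hSi
            cases hSi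
          have hnot : (i, b) ∉ T := fun h => hiT (Finset.mem_image.2 ⟨_, h, rfl⟩)
          refine ⟨insert (i, b) T, n + 1, hT'.insert hb hiT
            ⟨hib, by omega, hSi, fun l h1 h2 => hz' l h1 (by omega)⟩, ?_, le_rfl, by omega,
            fun l _ _ => by omega, ?_⟩
          · intro e he
            rcases Finset.mem_insert.1 he with rfl | he
            · simp only
              omega
            · exact (hb e he).trans (by omega)
          · by_cases hall : ∀ i' < n + 1, S i' = true →
              i' ∈ (insert (i, b) T).image Prod.fst
            · exact Or.inl hall
            · push Not at hall
              refine Or.inr ⟨hall, Function.update S' n true, t, ?_, ?_, ?_, by omega, by simp⟩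
              · rw [Finset.card_insert_of_notMem hnot]
                refine (Finset.card_le_card (t := insert n
                  ((Finset.range n).filter fun i => S' i ≠ S i)) fun x hx => ?_).trans
                  ((Finset.card_insert_le _ _).trans (by omega))
                simp only [Finset.mem_insert, Finset.mem_filter, Finset.mem_range] at hx ⊢
                by_cases hxn : x = n
                · exact Or.inl hxn
                · refine Or.inr ⟨by omega, ?_⟩
                  simpa [hxn] using hx.2
              · intro x hx
                rw [Function.update_of_ne (by omega)]
                exact h0 x hx
              · intro p hp hpk
                by_cases hpn : p + k ≤ n + 1
                · obtain ⟨l, h1, h2, h3⟩ := hw p hp hpn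
                  exact ⟨l, h1, h2, by rw [Function.update_of_ne (by omega)]; exact h3⟩
                · exact ⟨n, by omega, by omega, by simp⟩

/-- Erasing all ones suffices when every one is matched by the family `T`. -/
lemma exists_pFree_of_ones_subset {n k : ℕ} {P S : ℕ → Bool} (hk : 1 ≤ k) (hP0 : P 0 = true)
    {T : Finset (ℕ × ℕ)} (h : ∀ i < n, S i = true → i ∈ T.image Prod.fst) :
    ∃ S', PFree1 n k S' P ∧ ((Finset.range n).filter fun i => S' i ≠ S i).card ≤ T.card := by
  refine ⟨fun _ => false, fun i hi => ?_, ?_⟩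
  · have := hi.2 0 (by omega)
    simp [hP0] at this
  · simpa using card_ones_le h

lemma exists_family_pFree {n k : ℕ} {P S : ℕ → Bool} (hk : 1 ≤ k) (hP0 : P 0 = true)
    (hPl : ∀ l, 1 ≤ l → l < k → P l = false) :
    ∃ T, IsEvidenceFamily n k S T ∧ ∃ S', PFree1 n k S' P ∧
      ((Finset.range n).filter fun i => S' i ≠ S i).card ≤ T.card := by
  rcases hk.eq_or_lt with rfl | hk2
  · refine ⟨((Finset.range n).filter fun i => S i = true).image fun i => (i, n), ⟨?_, ?_⟩,
      exists_pFree_of_ones_subset le_rfl hP0 ?_⟩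
    · intro e he
      simp only [Finset.mem_image, Finset.mem_filter, Finset.mem_range] at he
      obtain ⟨i, ⟨hi, hSi⟩, rfl⟩ := he
      exact ⟨hi, le_rfl, hSi, fun l h1 h2 => by simp only at h1 h2; omega⟩
    · intro e he e' he' hne
      simp only [Finset.mem_image, Finset.mem_filter, Finset.mem_range] at he he'
      obtain ⟨i, -, rfl⟩ := he
      obtain ⟨i', -, rfl⟩ := he'
      refine ⟨fun h => hne (by simpa using h), by simp⟩
    · intro i hi hSi
      simp [hi, hSi]
  · obtain ⟨T, b, hT, -, -, -, -, hAB⟩ := exists_greedyState hk2 S n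
    refine ⟨T, hT, ?_⟩
    rcases hAB with hA | ⟨-, S', t, hc, h0, hw, -, -⟩
    · exact exists_pFree_of_ones_subset hk hP0 hA
    · refine ⟨S', fun i ⟨hin, hi⟩ => ?_, hc⟩
      have hSi : S' i = true := by simpa [hP0] using hi 0 (by omega)
      have hti : t ≤ i := by
        by_contra hlt
        rw [h0 i (by omega)] at hSi
        cases hSi
      obtain ⟨l, h1, h2, h3⟩ := hw (i + 1) (by omega) (by omega)
      have := hi (l - i) (by omega)
      rw [hPl _ (by omega) (by omega), Nat.add_sub_cancel' (by omega), h3] at this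
      cases this

/-- For the pattern `P = 10^{k-1}`, the deletion number of a binary string `S` of
length `n` equals the maximum number of pairwise non-overlapping `P`-evidences. -/
theorem stmt17 (n k : ℕ) (hk : 1 ≤ k) (P : ℕ → Bool)
    (hP0 : P 0 = true) (hPl : ∀ l, 1 ≤ l → l < k → P l = false)
    (S : ℕ → Bool) :
    delNum1 n k S P = evNum n k S := by
  have hcard : ∀ S' : ℕ → Bool, {i : ℕ | i < n ∧ S' i ≠ S i}.ncard =
      ((Finset.range n).filter fun i => S' i ≠ S i).card := by
    intro S'
    rw [← Set.ncard_coe_finset]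
    congr 1
    ext i
    simp
  obtain ⟨T, hT, S', hfree, hle⟩ := exists_family_pFree (n := n) (S := S) hk hP0 hPl
  apply le_antisymm
  · have h1 : delNum1 n k S P ≤ T.card := by
      refine le_trans ?_ ((hcard S').le.trans hle)
      exact Nat.sInf_le ⟨S', rfl, hfree⟩
    refine h1.trans (le_csSup ⟨T.card, ?_⟩ ⟨T, rfl, hT⟩)
    rintro m ⟨T', rfl, hT'⟩
    exact (IsEvidenceFamily.card_le hk hP0 hPl hfree hT').trans hle
  · refine csSup_le ⟨_, T, rfl, hT⟩ ?_
    rintro m ⟨T', rfl, hT'⟩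
    obtain ⟨S₁, h₁, hfree₁⟩ := Nat.sInf_mem (s := {m : ℕ | ∃ S' : ℕ → Bool,
      {i : ℕ | i < n ∧ S' i ≠ S i}.ncard = m ∧ PFree1 n k S' P}) ⟨_, S', rfl, hfree⟩
    exact (IsEvidenceFamily.card_le hk hP0 hPl hfree₁ hT').trans
      ((hcard S₁).symm.trans h₁).le
end
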